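/- Let (b,c) be a connected graph over a countably infinite set X. Then (b,c) is uniformly transient, i.e. D₀ ⊆ C₀(X), if and only if inf_{x∈X} cap(x) > 0, where cap(x) = inf{Q(φ) : φ ∈ C_c(X), φ(x) = 1}. -/

import Mathlib

open ENNReal Filter Topology

namespace UTGraph

variable {X : Type*}

/-- A graph over `X`: symmetric nonnegative edge weight `b` with zero diagonal and
summable rows, together with a nonnegative potential (killing term) `c`. -/
structure IsGraph (b : X → X → ℝ) (c : X → ℝ) : Prop where
  symm : ∀ x y, b x y = b y x
  nonneg : ∀ x y, 0 ≤ b x y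
  loopless : ∀ x, b x x = 0
  row_summable : ∀ x, Summable fun y => b x y
  c_nonneg : ∀ x, 0 ≤ c x

/-- Connectedness: any two vertices are joined by a path of positive edge weights. -/
def Connected (b : X → X → ℝ) : Prop :=
  ∀ x y : X, Relation.ReflTransGen (fun u v => 0 < b u v) x y

/-- The energy form `Q(f)`, with values in `[0,∞]`. -/
noncomputable def energy (b : X → X → ℝ) (c : X → ℝ) (f : X → ℝ) : ℝ≥0∞ :=
  (1 / 2) * ∑' p : X × X, ENNReal.ofReal (b p.1 p.2 * (f p.1 - f p.2) ^ 2)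
    + ∑' x, ENNReal.ofReal (c x * f x ^ 2)

/-- `f` has finite energy, i.e. `f ∈ D`. -/
def FiniteEnergy (b : X → X → ℝ) (c : X → ℝ) (f : X → ℝ) : Prop :=
  energy b c f < ⊤

/-- The bilinear energy form `Q(f,g)` (for finite-energy functions). -/
noncomputable def energyBilin (b : X → X → ℝ) (c : X → ℝ) (f g : X → ℝ) : ℝ :=
  (1 / 2) * ∑' p : X × X, b p.1 p.2 * (f p.1 - f p.2) * (g p.1 - g p.2)
    + ∑' x, c x * f x * g x

/-- `f ∈ C_c(X)`: finitely supported function. -/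
def FinSupp (f : X → ℝ) : Prop := (Function.support f).Finite

/-- The norm `‖f‖_o = (Q(f) + f(o)²)^{1/2}`. -/
noncomputable def normO (b : X → X → ℝ) (c : X → ℝ) (o : X) (f : X → ℝ) : ℝ :=
  Real.sqrt ((energy b c f).toReal + f o ^ 2)

/-- `f ∈ D₀`: there is a sequence of finitely supported functions converging to `f`
pointwise whose energy difference to `f` tends to `0`. -/
def MemD0 (b : X → X → ℝ) (c : X → ℝ) (f : X → ℝ) : Prop :=
  ∃ φ : ℕ → X → ℝ, (∀ n, FinSupp (φ n)) ∧
    (∀ x, Tendsto (fun n => φ n x) atTop (𝓝 (f x))) ∧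
    Tendsto (fun n => energy b c (φ n - f)) atTop (𝓝 0)

/-- `f ∈ C₀(X)`: `f` belongs to the uniform closure of the finitely supported functions,
i.e. for every `ε > 0` the set where `|f| ≥ ε` is finite. -/
def MemC0 (f : X → ℝ) : Prop := ∀ ε : ℝ, 0 < ε → {x | ε ≤ |f x|}.Finite

/-- The graph is uniformly transient: `D₀ ⊆ C₀(X)`. -/
def UniformlyTransient (b : X → X → ℝ) (c : X → ℝ) : Prop :=
  ∀ f : X → ℝ, MemD0 b c f → MemC0 f

/-- The capacity of a point: `cap(x) = inf {Q(φ) : φ ∈ C_c(X), φ(x) = 1}`. -/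
noncomputable def cap (b : X → X → ℝ) (c : X → ℝ) (x : X) : ℝ≥0∞ :=
  ⨅ (φ : X → ℝ) (_ : FinSupp φ) (_ : φ x = 1), energy b c φ

/-- `f ∈ F`: the domain of the formal Laplacian. -/
def MemF (b : X → X → ℝ) (f : X → ℝ) : Prop :=
  ∀ x, Summable fun y => b x y * |f y|

/-- The formal Laplacian `𝓛 f (x) = Σ_y b(x,y)(f(x) - f(y)) + c(x) f(x)`. -/
noncomputable def formalLaplacian (b : X → X → ℝ) (c : X → ℝ) (f : X → ℝ) (x : X) : ℝ :=
  (∑' y, b x y * (f x - f y)) + c x * f x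

/-- `f` is harmonic: `f ∈ F` and `𝓛 f = 0`. -/
def Harmonic (b : X → X → ℝ) (c : X → ℝ) (f : X → ℝ) : Prop :=
  MemF b f ∧ ∀ x, formalLaplacian b c f x = 0

/-- The graph is recurrent: the constant function `1` lies in `D₀` and `Q(1) = 0`. -/
def Recurrent (b : X → X → ℝ) (c : X → ℝ) : Prop :=
  MemD0 b c 1 ∧ energy b c 1 = 0

/-- The graph is transient: not recurrent. -/
def Transient (b : X → X → ℝ) (c : X → ℝ) : Prop := ¬ Recurrent b c

/-- The metric `γ_o`. -/
noncomputable def gammaO (b : X → X → ℝ) (c : X → ℝ) (o x y : X) : ℝ :=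
  sSup {d : ℝ | ∃ φ : X → ℝ, FinSupp φ ∧
    energy b c φ + ENNReal.ofReal (φ o ^ 2) ≤ 1 ∧ d = |φ x - φ y|}

/-- The metric `γ`. -/
noncomputable def gamma (b : X → X → ℝ) (c : X → ℝ) (x y : X) : ℝ :=
  sSup {d : ℝ | ∃ φ : X → ℝ, FinSupp φ ∧ energy b c φ ≤ 1 ∧ d = |φ x - φ y|}

/-- `d` is a metric on `X`. -/
def IsMetric (d : X → X → ℝ) : Prop :=
  (∀ x y, 0 ≤ d x y) ∧ (∀ x y, d x y = d y x) ∧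
  (∀ x y, d x y = 0 ↔ x = y) ∧ (∀ x y z, d x z ≤ d x y + d y z)

/-- `f` belongs to the closure of `C_c(X)` with respect to the norm
`‖·‖_Q = (Q(·) + ‖·‖_m²)^{1/2}` inside `D ∩ ℓ²(X,m)`. -/
def MemFormDomain (b : X → X → ℝ) (c : X → ℝ) (m : X → ℝ) (f : X → ℝ) : Prop :=
  FiniteEnergy b c f ∧ Summable (fun x => m x * f x ^ 2) ∧
  ∃ φ : ℕ → X → ℝ, (∀ n, FinSupp (φ n)) ∧
    Tendsto (fun n => energy b c (f - φ n)
      + ∑' x, ENNReal.ofReal (m x * (f x - φ n x) ^ 2)) atTop (𝓝 0)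

end UTGraph

namespace UTGraph

variable {X : Type*} {b : X → X → ℝ} {c : X → ℝ}

/-- If every edge term and every killing term of `f` is dominated, then so is the energy. -/
theorem energy_mono (hb : ∀ x y, 0 ≤ b x y) (hc : ∀ x, 0 ≤ c x) {f g : X → ℝ}
    (hd : ∀ x y, (f x - f y) ^ 2 ≤ (g x - g y) ^ 2) (hv : ∀ x, f x ^ 2 ≤ g x ^ 2) :
    energy b c f ≤ energy b c g := by
  unfold energy
  refine add_le_add (mul_le_mul_right (ENNReal.tsum_le_tsum fun p => ?_) _)
    (ENNReal.tsum_le_tsum fun x => ?_)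
  · exact ENNReal.ofReal_le_ofReal (mul_le_mul_of_nonneg_left (hd _ _) (hb _ _))
  · exact ENNReal.ofReal_le_ofReal (mul_le_mul_of_nonneg_left (hv _) (hc _))

theorem energy_abs_le (hb : ∀ x y, 0 ≤ b x y) (hc : ∀ x, 0 ≤ c x) (f : X → ℝ) :
    energy b c (fun x => |f x|) ≤ energy b c f :=
  energy_mono hb hc (fun _ _ => sq_le_sq.mpr (abs_abs_sub_abs_le_abs_sub _ _))
    (fun _ => (sq_abs _).le)

theorem energy_neg (f : X → ℝ) : energy b c (-f) = energy b c f := by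
  have h : ∀ x y, (-f x - -f y) ^ 2 = (f x - f y) ^ 2 := fun x y => by ring
  simp only [energy, Pi.neg_apply, h, neg_sq]

theorem energy_smul (a : ℝ) (f : X → ℝ) :
    energy b c (a • f) = ENNReal.ofReal (a ^ 2) * energy b c f := by
  have h : ∀ w t : ℝ, ENNReal.ofReal (w * (a * t) ^ 2)
      = ENNReal.ofReal (a ^ 2) * ENNReal.ofReal (w * t ^ 2) := fun w t => by
    rw [← ENNReal.ofReal_mul (sq_nonneg a)]
    ring_nf
  simp only [energy, Pi.smul_apply, smul_eq_mul, ← mul_sub, h, ENNReal.tsum_mul_left]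
  ring

theorem ofReal_mul_add_sq_le {w : ℝ} (hw : 0 ≤ w) (s t : ℝ) :
    ENNReal.ofReal (w * (s + t) ^ 2)
      ≤ 2 * ENNReal.ofReal (w * s ^ 2) + 2 * ENNReal.ofReal (w * t ^ 2) := by
  have h2 : (2 : ℝ≥0∞) = ENNReal.ofReal 2 := by simp
  rw [h2, ← ENNReal.ofReal_mul zero_le_two, ← ENNReal.ofReal_mul zero_le_two,
    ← ENNReal.ofReal_add (by positivity) (by positivity)]
  apply ENNReal.ofReal_le_ofReal
  nlinarith [mul_nonneg hw (sq_nonneg (s - t))]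

theorem energy_add_le (hb : ∀ x y, 0 ≤ b x y) (hc : ∀ x, 0 ≤ c x) (f g : X → ℝ) :
    energy b c (f + g) ≤ 2 * energy b c f + 2 * energy b c g := by
  have h1 : ∑' p : X × X, ENNReal.ofReal (b p.1 p.2 * ((f + g) p.1 - (f + g) p.2) ^ 2)
      ≤ 2 * ∑' p : X × X, ENNReal.ofReal (b p.1 p.2 * (f p.1 - f p.2) ^ 2)
        + 2 * ∑' p : X × X, ENNReal.ofReal (b p.1 p.2 * (g p.1 - g p.2) ^ 2) := by
    rw [← ENNReal.tsum_mul_left, ← ENNReal.tsum_mul_left, ← ENNReal.tsum_add]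
    refine ENNReal.tsum_le_tsum fun p => ?_
    rw [Pi.add_apply, Pi.add_apply, add_sub_add_comm]
    exact ofReal_mul_add_sq_le (hb _ _) _ _
  have h2 : ∑' x, ENNReal.ofReal (c x * (f + g) x ^ 2)
      ≤ 2 * ∑' x, ENNReal.ofReal (c x * f x ^ 2)
        + 2 * ∑' x, ENNReal.ofReal (c x * g x ^ 2) := by
    rw [← ENNReal.tsum_mul_left, ← ENNReal.tsum_mul_left, ← ENNReal.tsum_add]
    exact ENNReal.tsum_le_tsum fun x => ofReal_mul_add_sq_le (hc _) _ _
  unfold energy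
  calc _ ≤ _ := add_le_add (mul_le_mul_right h1 (1 / 2)) h2
    _ = _ := by ring

/-- Lower semicontinuity of the energy under pointwise convergence. -/
theorem energy_le_of_tendsto {g : ℕ → X → ℝ} {f : X → ℝ} {C : ℝ≥0∞}
    (hg : ∀ x, Tendsto (fun n => g n x) atTop (𝓝 (f x)))
    (hC : ∀ n, energy b c (g n) ≤ C) : energy b c f ≤ C := by
  have hpart : ∀ s : Finset (X × X) × Finset X,
      (1 / 2) * ∑ p ∈ s.1, ENNReal.ofReal (b p.1 p.2 * (f p.1 - f p.2) ^ 2)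
        + ∑ x ∈ s.2, ENNReal.ofReal (c x * f x ^ 2) ≤ C := by
    intro s
    have hlim : Tendsto (fun n =>
        (1 / 2) * ∑ p ∈ s.1, ENNReal.ofReal (b p.1 p.2 * (g n p.1 - g n p.2) ^ 2)
          + ∑ x ∈ s.2, ENNReal.ofReal (c x * g n x ^ 2)) atTop
        (𝓝 ((1 / 2) * ∑ p ∈ s.1, ENNReal.ofReal (b p.1 p.2 * (f p.1 - f p.2) ^ 2)
          + ∑ x ∈ s.2, ENNReal.ofReal (c x * f x ^ 2))) := by
      refine Tendsto.add (ENNReal.Tendsto.const_mul ?_ (Or.inr (by simp))) ?_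
      · exact tendsto_finsetSum _ fun p _ => ENNReal.tendsto_ofReal
          ((((hg p.1).sub (hg p.2)).pow 2).const_mul _)
      · exact tendsto_finsetSum _ fun x _ => ENNReal.tendsto_ofReal
          (((hg x).pow 2).const_mul _)
    refine le_of_tendsto' hlim fun n => le_trans ?_ (hC n)
    unfold energy
    gcongr <;> exact ENNReal.sum_le_tsum _
  have hsum : Tendsto (fun s : Finset (X × X) × Finset X =>
      (1 / 2) * ∑ p ∈ s.1, ENNReal.ofReal (b p.1 p.2 * (f p.1 - f p.2) ^ 2)
        + ∑ x ∈ s.2, ENNReal.ofReal (c x * f x ^ 2)) (atTop ×ˢ atTop)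
      (𝓝 (energy b c f)) := by
    have h1 := (ENNReal.summable (f := fun p : X × X =>
      ENNReal.ofReal (b p.1 p.2 * (f p.1 - f p.2) ^ 2))).hasSum
    have h2 := (ENNReal.summable (f := fun x : X => ENNReal.ofReal (c x * f x ^ 2))).hasSum
    simp only [HasSum, SummationFilter.unconditional_filter] at h1 h2
    exact (ENNReal.Tendsto.const_mul (h1.comp tendsto_fst) (Or.inr (by simp))).add
      (h2.comp tendsto_snd)
  exact le_of_tendsto' hsum hpart

theorem ofReal_edge_le (f : X → ℝ) (x y : X) :
    ENNReal.ofReal (b x y * (f x - f y) ^ 2) ≤ 2 * energy b c f := by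
  have h := ENNReal.le_tsum (f := fun p : X × X =>
    ENNReal.ofReal (b p.1 p.2 * (f p.1 - f p.2) ^ 2)) (x, y)
  refine h.trans ?_
  unfold energy
  rw [mul_add, ← mul_assoc, one_div, ENNReal.mul_inv_cancel two_ne_zero ENNReal.ofNat_ne_top,
    one_mul]
  exact le_self_add

theorem ofReal_killing_le (f : X → ℝ) (x : X) :
    ENNReal.ofReal (c x * f x ^ 2) ≤ energy b c f :=
  (ENNReal.le_tsum (f := fun x : X => ENNReal.ofReal (c x * f x ^ 2)) x).trans le_add_self

theorem cap_mul_sq_le {φ : X → ℝ} (hφ : FinSupp φ) (x : X) :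
    cap b c x * ENNReal.ofReal (φ x ^ 2) ≤ energy b c φ := by
  by_cases h0 : φ x = 0
  · simp [h0]
  have hle : cap b c x ≤ energy b c ((φ x)⁻¹ • φ) :=
    iInf₂_le_of_le _ (hφ.subset (Function.support_const_smul_subset _ _))
      (iInf_le_of_le (by simp [h0]) le_rfl)
  calc cap b c x * ENNReal.ofReal (φ x ^ 2)
      ≤ energy b c ((φ x)⁻¹ • φ) * ENNReal.ofReal (φ x ^ 2) := by gcongr
    _ = energy b c φ := by
      rw [energy_smul, mul_comm, ← mul_assoc, ← ENNReal.ofReal_mul (sq_nonneg _), ← mul_pow,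
        mul_inv_cancel₀ h0]
      simp

theorem exists_finSupp_energy_lt {x : X} {ε : ℝ≥0∞} (h : cap b c x < ε) :
    ∃ φ : X → ℝ, FinSupp φ ∧ φ x = 1 ∧ energy b c φ < ε := by
  simp only [cap, iInf_lt_iff] at h
  obtain ⟨φ, h1, h2, h3⟩ := h
  exact ⟨φ, h1, h2, h3⟩

theorem FinSupp.sub {f g : X → ℝ} (hf : FinSupp f) (hg : FinSupp g) : FinSupp (f - g) :=
  (hf.union hg).subset (Function.support_sub f g)

theorem uniformlyTransient_of_iInf_cap_pos (hb : ∀ x y, 0 ≤ b x y) (hc : ∀ x, 0 ≤ c x)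
    (h : 0 < ⨅ x, cap b c x) : UniformlyTransient b c := by
  rintro f ⟨φ, hfin, hpt, hlim⟩ ε hε
  obtain ⟨C, hC0, hC⟩ := ENNReal.lt_iff_exists_nnreal_btwn.mp h
  set η : ℝ≥0∞ := C * ENNReal.ofReal ((ε / 2) ^ 2) with hη
  have hη0 : 0 < η := ENNReal.mul_pos hC0.ne' (ENNReal.ofReal_pos.mpr (by positivity)).ne'
  have hev : ∀ᶠ n in atTop, energy b c (φ n - f) ≤ η / 4 :=
    (hlim.eventually_lt_const (ENNReal.div_pos hη0.ne' (by simp))).mono fun _ h => h.le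
  obtain ⟨N, hN⟩ := eventually_atTop.mp hev
  have hdiff : ∀ m ≥ N, energy b c (φ N - φ m) ≤ η := fun m hm => by
    have h1 := energy_add_le hb hc (φ N - f) (-(φ m - f))
    rw [energy_neg, neg_sub, sub_add_sub_cancel] at h1
    calc _ ≤ _ := h1
      _ ≤ 2 * (η / 4) + 2 * (η / 4) := by
        gcongr
        exacts [hN N le_rfl, hN m hm]
      _ = 4 * (η / 4) := by ring
      _ ≤ η := ENNReal.mul_div_le
  have hclose : ∀ x, |φ N x - f x| ≤ ε / 2 := fun x => by
    have hl : Tendsto (fun m => (C : ℝ≥0∞) * ENNReal.ofReal ((φ N x - φ m x) ^ 2)) atTop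
        (𝓝 (C * ENNReal.ofReal ((φ N x - f x) ^ 2))) :=
      ENNReal.Tendsto.const_mul
        (ENNReal.tendsto_ofReal (((hpt x).const_sub _).pow 2)) (Or.inr (by simp))
    have hle : C * ENNReal.ofReal ((φ N x - f x) ^ 2) ≤ η := by
      refine le_of_tendsto hl (eventually_atTop.mpr ⟨N, fun m hm => ?_⟩)
      refine le_trans ?_ ((cap_mul_sq_le ((hfin N).sub (hfin m)) x).trans (hdiff m hm))
      exact mul_le_mul_left (hC.le.trans (iInf_le _ x)) _
    rw [hη, ENNReal.mul_le_mul_iff_right hC0.ne' (by simp),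
      ENNReal.ofReal_le_ofReal_iff (by positivity)] at hle
    exact abs_le_of_sq_le_sq hle (by positivity)
  refine (hfin N).subset fun x hx => ?_
  rw [Function.mem_support]
  intro h0
  have := hclose x
  rw [h0, zero_sub, abs_neg] at this
  have hx' : ε ≤ |f x| := hx
  linarith

theorem tendsto_of_mul_sub_sq {ι : Type*} {l : Filter ι} {w : ℝ} (hw : 0 < w)
    {u v : ι → ℝ} {a : ℝ}
    (hu : Tendsto u l (𝓝 a)) {E : ι → ℝ≥0∞} (hE : Tendsto E l (𝓝 0))
    (h : ∀ i, ENNReal.ofReal (w * (u i - v i) ^ 2) ≤ E i) : Tendsto v l (𝓝 a) := by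
  have h1 : Tendsto (fun i => ENNReal.ofReal (w * (u i - v i) ^ 2)) l (𝓝 0) :=
    tendsto_of_tendsto_of_tendsto_of_le_of_le tendsto_const_nhds hE (fun _ => zero_le) h
  have h2 : Tendsto (fun i => w * (u i - v i) ^ 2) l (𝓝 0) := by
    have := (ENNReal.tendsto_toReal ENNReal.zero_ne_top).comp h1
    refine this.congr fun i => ?_
    exact ENNReal.toReal_ofReal (by positivity)
  have h3 : Tendsto (fun i => |u i - v i|) l (𝓝 0) := by
    have := (h2.const_mul w⁻¹).sqrt
    simp only [inv_mul_cancel_left₀ hw.ne', Real.sqrt_sq_eq_abs, mul_zero, Real.sqrt_zero] at this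
    exact this
  have h4 : Tendsto (fun i => u i - v i) l (𝓝 0) := (tendsto_zero_iff_abs_tendsto_zero _).mpr h3
  simpa using hu.sub h4

/-- On a connected graph, a point of capacity zero forces the constant function `1` into `D₀`. -/
theorem memD0_one_of_cap_eq_zero (hc : ∀ x, 0 ≤ c x)
    (hconn : Connected b) {x : X} (h : cap b c x = 0) : MemD0 b c 1 := by
  have hex : ∀ n : ℕ, ∃ φ : X → ℝ, FinSupp φ ∧ φ x = 1 ∧ energy b c φ < ((n : ℝ≥0∞))⁻¹ :=
    fun n => exists_finSupp_energy_lt (by rw [h]; simp)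
  choose φ hfin hone hlt using hex
  have hE : Tendsto (fun n => energy b c (φ n)) atTop (𝓝 0) :=
    tendsto_of_tendsto_of_tendsto_of_le_of_le tendsto_const_nhds
      ENNReal.tendsto_inv_nat_nhds_zero (fun _ => zero_le) fun n => (hlt n).le
  have hpt : ∀ y, Tendsto (fun n => φ n y) atTop (𝓝 1) := fun y => by
    induction hconn x y with
    | refl => simp [hone]
    | tail _ huv ih =>
      refine tendsto_of_mul_sub_sq huv ih (E := fun n => 2 * energy b c (φ n)) ?_
        fun n => ofReal_edge_le (φ n) _ _
      simpa using ENNReal.Tendsto.const_mul hE (Or.inr (by simp : (2 : ℝ≥0∞) ≠ ⊤))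
  have hc0 : ∀ y, c y = 0 := fun y => by
    have hl : Tendsto (fun n => ENNReal.ofReal (c y * φ n y ^ 2)) atTop
        (𝓝 (ENNReal.ofReal (c y * 1 ^ 2))) :=
      ENNReal.tendsto_ofReal (((hpt y).pow 2).const_mul _)
    have := le_of_tendsto_of_tendsto' hl hE fun n => ofReal_killing_le (φ n) y
    rw [nonpos_iff_eq_zero, ENNReal.ofReal_eq_zero] at this
    linarith [hc y]
  refine ⟨φ, hfin, hpt, hE.congr fun n => ?_⟩
  simp [energy, hc0]

/-- Partial sums of a sequence with geometrically decaying energies are uniformly Cauchy in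
energy. -/
theorem energy_sum_Ico_le (hb : ∀ x y, 0 ≤ b x y) (hc : ∀ x, 0 ≤ c x) {φ : ℕ → X → ℝ}
    (hφ : ∀ k, energy b c (φ k) ≤ (4⁻¹ : ℝ≥0∞) ^ k) (j n : ℕ) :
    energy b c (∑ k ∈ Finset.Ico n (n + j), φ k) ≤ 4 * 4⁻¹ ^ n := by
  induction j generalizing n with
  | zero => simp [energy]
  | succ j ih =>
    rw [Finset.sum_eq_sum_Ico_succ_bot (by lia), show n + (j + 1) = n + 1 + j by ring]
    calc _ ≤ _ := energy_add_le hb hc _ _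
      _ ≤ 2 * 4⁻¹ ^ n + 2 * (4 * 4⁻¹ ^ (n + 1)) := by
        gcongr
        exacts [hφ n, ih (n + 1)]
      _ = 2 * 4⁻¹ ^ n + 2 * (4 * 4⁻¹ * 4⁻¹ ^ n) := by ring
      _ = 4 * 4⁻¹ ^ n := by
        rw [ENNReal.mul_inv_cancel (by simp) (by simp)]
        ring

theorem finSupp_sum {ι : Type*} (s : Finset ι) {φ : ι → X → ℝ} (hφ : ∀ k, FinSupp (φ k)) :
    FinSupp (∑ k ∈ s, φ k) := by
  refine (s.finite_toSet.biUnion fun k _ => hφ k).subset ?_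
  intro x hx
  rw [Function.mem_support, Finset.sum_apply] at hx
  obtain ⟨k, hk, hne⟩ := Finset.exists_ne_zero_of_sum_ne_zero hx
  exact Set.mem_biUnion hk hne

theorem memD0_of_hasSum (hb : ∀ x y, 0 ≤ b x y) (hc : ∀ x, 0 ≤ c x) {φ : ℕ → X → ℝ}
    (hfin : ∀ k, FinSupp (φ k)) (hφ : ∀ k, energy b c (φ k) ≤ (4⁻¹ : ℝ≥0∞) ^ k) {f : X → ℝ}
    (hf : ∀ x, HasSum (fun k => φ k x) (f x)) : MemD0 b c f := by
  have hpt : ∀ x, Tendsto (fun n => (∑ k ∈ Finset.range n, φ k) x) atTop (𝓝 (f x)) := fun x => by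
    simpa only [Finset.sum_apply] using (hf x).tendsto_sum_nat
  refine ⟨fun n => ∑ k ∈ Finset.range n, φ k, fun n => finSupp_sum _ hfin, hpt, ?_⟩
  have hbound : ∀ n, energy b c (∑ k ∈ Finset.range n, φ k - f) ≤ 4 * 4⁻¹ ^ n := fun n => by
    rw [← energy_neg, neg_sub]
    refine energy_le_of_tendsto (g := fun j => ∑ k ∈ Finset.Ico n (n + j), φ k) (fun x => ?_)
      fun j => energy_sum_Ico_le hb hc hφ j n
    have h1 := ((hpt x).comp (tendsto_add_atTop_nat n)).sub_const ((∑ k ∈ Finset.range n, φ k) x)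
    refine h1.congr fun j => ?_
    rw [Finset.sum_Ico_eq_sub _ (Nat.le_add_right n j), Pi.sub_apply, Function.comp_apply,
      add_comm j n]
  have hgeo : Tendsto (fun n : ℕ => (4 : ℝ≥0∞) * 4⁻¹ ^ n) atTop (𝓝 0) := by
    have := ENNReal.Tendsto.const_mul (a := 4)
      (ENNReal.tendsto_pow_atTop_nhds_zero_of_lt_one (r := 4⁻¹)
        (ENNReal.inv_lt_one.mpr (by norm_num))) (Or.inr (by simp))
    simpa using this
  exact tendsto_of_tendsto_of_tendsto_of_le_of_le tendsto_const_nhds hgeo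
    (fun _ => zero_le) hbound

theorem summable_apply_of_cap_ne_zero {φ : ℕ → X → ℝ} (hfin : ∀ k, FinSupp (φ k))
    (hφ : ∀ k, energy b c (φ k) ≤ (4⁻¹ : ℝ≥0∞) ^ k) {x : X} (hx : cap b c x ≠ 0) :
    Summable fun k => φ k x := by
  obtain ⟨C, hC0, hC⟩ := ENNReal.lt_iff_exists_nnreal_btwn.mp (pos_iff_ne_zero.mpr hx)
  have hC0' : (0 : ℝ) < C := by exact_mod_cast hC0
  refine Summable.of_norm_bounded (g := fun k => √((C : ℝ)⁻¹) * (1 / 2) ^ k)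
    (summable_geometric_two.mul_left _) fun k => ?_
  have h1 : ENNReal.ofReal (C * φ k x ^ 2) ≤ ENNReal.ofReal ((4⁻¹ : ℝ) ^ k) := by
    rw [ENNReal.ofReal_mul hC0'.le, ENNReal.ofReal_coe_nnreal,
      ENNReal.ofReal_pow (p := 4⁻¹) (by positivity),
      ENNReal.ofReal_inv_of_pos (by positivity), ENNReal.ofReal_ofNat]
    refine le_trans ?_ ((cap_mul_sq_le (hfin k) x).trans (hφ k))
    gcongr
  rw [ENNReal.ofReal_le_ofReal_iff (by positivity)] at h1
  refine abs_le_of_sq_le_sq ?_ (by positivity)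
  rw [mul_pow, Real.sq_sqrt (by positivity), ← pow_mul, mul_comm k 2, pow_mul,
    inv_mul_eq_div, le_div_iff₀ hC0']
  norm_num at h1 ⊢
  linarith

theorem iInf_cap_pos_of_uniformlyTransient [Infinite X] (hb : ∀ x y, 0 ≤ b x y)
    (hc : ∀ x, 0 ≤ c x) (hconn : Connected b) (h : UniformlyTransient b c) :
    0 < ⨅ x, cap b c x := by
  by_contra hinf
  rw [not_lt, nonpos_iff_eq_zero] at hinf
  have hcap : ∀ x, cap b c x ≠ 0 := fun x hx => by
    have := h 1 (memD0_one_of_cap_eq_zero hc hconn hx) 1 one_pos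
    simp only [Pi.one_apply, abs_one, le_refl, Set.ofPred_true] at this
    exact Set.infinite_univ this
  have hpos : ∀ k : ℕ, (0 : ℝ≥0∞) < 4⁻¹ ^ k := fun k =>
    ENNReal.pow_pos (by simp) k
  have hex : ∀ k : ℕ, ∃ x, cap b c x < (4⁻¹ : ℝ≥0∞) ^ k := fun k =>
    iInf_lt_iff.mp (hinf ▸ hpos k)
  choose x hx using hex
  choose ψ hψfin hψone hψlt using fun k => exists_finSupp_energy_lt (hx k)
  have hfin : ∀ k, FinSupp fun y => |ψ k y| := fun k =>
    (hψfin k).subset fun y hy => by simpa using hy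
  have hle : ∀ k, energy b c (fun y => |ψ k y|) ≤ (4⁻¹ : ℝ≥0∞) ^ k := fun k =>
    (energy_abs_le hb hc _).trans (hψlt k).le
  have hsum : ∀ y, Summable fun k => |ψ k y| := fun y =>
    summable_apply_of_cap_ne_zero hfin hle (hcap y)
  have hS := h _ (memD0_of_hasSum hb hc hfin hle fun y => (hsum y).hasSum) 1 one_pos
  have hmem : ∀ k, x k ∈ {y | 1 ≤ abs (∑' k, |ψ k y|)} := fun k => by
    have h1 := (hsum (x k)).le_tsum k fun j _ => abs_nonneg _
    rw [hψone, abs_one] at h1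
    exact h1.trans (le_abs_self _)
  obtain ⟨y, -, hy⟩ := Set.exists_min_image _ (cap b c) hS ⟨x 0, hmem 0⟩
  have hgeo := ENNReal.tendsto_pow_atTop_nhds_zero_of_lt_one (r := 4⁻¹)
    (ENNReal.inv_lt_one.mpr (by norm_num))
  exact hcap y (nonpos_iff_eq_zero.mp
    (ge_of_tendsto' hgeo fun k => (hy _ (hmem k)).trans (hx k).le))

end UTGraph

open UTGraph Filter Topology ENNReal in
/-- uniform transience is equivalent to a uniform positive lower bound
on the capacities of points. -/
theorem stmt5 {X : Type*} [Countable X] [Infinite X]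
    (b : X → X → ℝ) (c : X → ℝ) (hgraph : IsGraph b c) (hconn : Connected b) :
    UniformlyTransient b c ↔ 0 < ⨅ x : X, cap b c x :=
  ⟨iInf_cap_pos_of_uniformlyTransient hgraph.nonneg hgraph.c_nonneg hconn,
    uniformlyTransient_of_iInf_cap_pos hgraph.nonneg hgraph.c_nonneg⟩
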